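/- Fix b ≥ 1 and g = 4b². Let D be a digraph of directed girth at least g such that for every arc (x,y) of D, either D contains a directed cycle of length exactly g through (x,y), or there is a vertex z ∈ V(D)∖{x,y} with (z,x),(z,y) ∈ A(D). Then for every arc (p,q) of D there is a gadget G contained in D, of type I or extended type II, with designated vertices p(G) = p and q(G) = q, and with |V(G)| ≤ 2g. -/

import Mathlib

/- Common definitions: digraphs as irreflexive-in-intent relations `V → V → Prop`,
   directed paths as nonempty duplicate-free lists of vertices,
   subdivisions, gadgets, alternating paths and chains, following
   "Subdivisions in digraphs of large out-degree or large dichromatic number". -/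

namespace Paper

variable {V : Type*}

/-- `p` is a directed path in the digraph `D`: a nonempty list of pairwise distinct
vertices in which consecutive vertices are joined by an arc of `D`.
Its length (number of arcs) is `p.length - 1`. -/
def IsDipathList (D : V → V → Prop) (p : List V) : Prop :=
  p ≠ [] ∧ p.Nodup ∧ p.Chain' D

/-- The out-degree of a vertex. -/
noncomputable def outDeg (D : V → V → Prop) (v : V) : ℕ :=
  Set.ncard {w | D v w}

/-- The digraph `D` contains a subdivision of the digraph `F`: there is an injective
embedding `φ` of the branch vertices and, for every arc `(x,y)` of `F`, a directed path
in `D` from `φ x` to `φ y` of length at least one, such that the internal vertices of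
these paths avoid the branch vertices and the paths of distinct arcs are internally
vertex-disjoint. -/
def ContainsSubdivisionOf {W : Type*} (D : V → V → Prop) (F : W → W → Prop) : Prop :=
  ∃ (φ : W → V) (P : W → W → List V),
    Function.Injective φ ∧
    (∀ ⦃x y⦄, F x y → IsDipathList D (P x y) ∧ (P x y).head? = some (φ x) ∧
      (P x y).getLast? = some (φ y) ∧ 2 ≤ (P x y).length ∧
      ∀ z ∈ (P x y).tail.dropLast, ∀ w, φ w ≠ z) ∧
    (∀ ⦃x y x' y'⦄, F x y → F x' y' → (x, y) ≠ (x', y') →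
      ∀ z ∈ (P x y).tail.dropLast, z ∉ P x' y')

/-- As `ContainsSubdivisionOf`, but moreover the subdivision spans exactly
the vertex set `S`. -/
def SpansSubdivisionOf {W : Type*} (D : V → V → Prop) (S : Set V) (F : W → W → Prop) : Prop :=
  ∃ (φ : W → V) (P : W → W → List V),
    Function.Injective φ ∧
    (∀ ⦃x y⦄, F x y → IsDipathList D (P x y) ∧ (P x y).head? = some (φ x) ∧
      (P x y).getLast? = some (φ y) ∧ 2 ≤ (P x y).length ∧
      ∀ z ∈ (P x y).tail.dropLast, ∀ w, φ w ≠ z) ∧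
    (∀ ⦃x y x' y'⦄, F x y → F x' y' → (x, y) ≠ (x', y') →
      ∀ z ∈ (P x y).tail.dropLast, z ∉ P x' y') ∧
    S = Set.range φ ∪ {z | ∃ x y, F x y ∧ z ∈ P x y}

/-- The biorientation of the triangle minus one arc: vertices `0,1,2` and arcs
`(0,1),(1,0),(1,2),(2,1),(0,2)`. -/
def K3e : Fin 3 → Fin 3 → Prop := fun x y =>
  (x, y) = (0, 1) ∨ (x, y) = (1, 0) ∨ (x, y) = (1, 2) ∨ (x, y) = (2, 1) ∨ (x, y) = (0, 2)

/-- The biorientation of the complete graph on four vertices. -/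
def K4bi : Fin 4 → Fin 4 → Prop := fun x y => x ≠ y

/-- The biorientation of the star with four edges (center `0`). -/
def S4bi : Fin 5 → Fin 5 → Prop := fun x y => x ≠ y ∧ (x = 0 ∨ y = 0)

/-- The orientation of the cycle of length `ℓ` (vertex set `ZMod ℓ`) determined by
`σ`: the edge `{x, x+1}` is oriented from `x` to `x+1` if `σ x = true`, and from
`x+1` to `x` otherwise. -/
def CycleOrientation (ℓ : ℕ) (σ : ZMod ℓ → Bool) : ZMod ℓ → ZMod ℓ → Prop :=
  fun x y => (σ x = true ∧ y = x + 1) ∨ (σ y = false ∧ x = y + 1)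

/-- The oriented cycle `C_{a,b}` on `2ab` vertices: going around the cycle
`ZMod (2ab)`, the arcs of the `j`-th block of `b` consecutive edges are oriented
forwards for even `j` and backwards for odd `j`; its sources are `s_j = 2bj`
and its sinks are `t_j = 2bj + b`, joined by `2a` internally disjoint directed
paths of length `b` each. -/
def Cab (a b : ℕ) : ZMod (2 * a * b) → ZMod (2 * a * b) → Prop := fun x y =>
  ∃ i : ℕ, i < 2 * a * b ∧
    (((i / b) % 2 = 0 ∧ x = (i : ZMod (2 * a * b)) ∧ y = ((i + 1 : ℕ) : ZMod (2 * a * b))) ∨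
     ((i / b) % 2 = 1 ∧ x = ((i + 1 : ℕ) : ZMod (2 * a * b)) ∧ y = (i : ZMod (2 * a * b))))

/-- The directed girth of `D` is at least `g`: every directed cycle
(a nonempty duplicate-free list `v :: p` with consecutive arcs and an arc from the
last vertex back to `v`) has length at least `g`. -/
def DirGirthGE (D : V → V → Prop) (g : ℕ) : Prop :=
  ∀ (v : V) (p : List V), (v :: p).Nodup → List.Chain D v (p ++ [v]) → g ≤ p.length + 1

/-- `D` is strongly connected. -/
def StronglyConnected (D : V → V → Prop) : Prop :=
  ∀ u v : V, Relation.ReflTransGen D u v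

/-- `D` is strongly `k`-arc-connected: after deleting any set of at most `k-1` arcs,
the digraph remains strongly connected. -/
def StronglyArcConnected (D : V → V → Prop) (k : ℕ) : Prop :=
  ∀ E : Finset (V × V), E.card < k →
    StronglyConnected (fun u v => D u v ∧ (u, v) ∉ E)

/-- `x` and `y` are consecutive (in this order) in the list `l`. -/
def adjIn (l : List V) (x y : V) : Prop := ∃ l₁ l₂, l = l₁ ++ x :: y :: l₂

/-- A type-I gadget in `D`: a directed cycle `p, q, rest…` of length at least `g`
through the arc `(p,q)`. -/
structure TypeIGadget (D : V → V → Prop) (g : ℕ) where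
  p : V
  q : V
  rest : List V
  nodup : (p :: q :: rest).Nodup
  chain : List.Chain D p (q :: (rest ++ [p]))
  glen : g ≤ rest.length + 2

def TypeIGadget.verts {D : V → V → Prop} {g : ℕ} (G : TypeIGadget D g) : Set V :=
  {x | x ∈ G.p :: G.q :: G.rest}

def TypeIGadget.arcs {D : V → V → Prop} {g : ℕ} (G : TypeIGadget D g) : V → V → Prop :=
  adjIn (G.p :: G.q :: (G.rest ++ [G.p]))

/-- A basic type-II gadget in `D` (with girth parameter `b`): vertices `p, q, r` and a
directed path `P₁` from `r` to `p` of length at least `2b² + b - 2` avoiding `q`,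
all of whose vertices send an arc to `q`. -/
structure BasicIIGadget (D : V → V → Prop) (b : ℕ) where
  p : V
  q : V
  r : V
  P₁ : List V
  path₁ : IsDipathList D P₁
  first₁ : P₁.head? = some r
  last₁ : P₁.getLast? = some p
  len₁ : 2 * b ^ 2 + b - 1 ≤ P₁.length
  hq : q ∉ P₁
  toq : ∀ x ∈ P₁, D x q

def BasicIIGadget.verts {D : V → V → Prop} {b : ℕ} (G : BasicIIGadget D b) : Set V :=
  insert G.q {x | x ∈ G.P₁}

def BasicIIGadget.arcs {D : V → V → Prop} {b : ℕ} (G : BasicIIGadget D b) :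
    V → V → Prop :=
  fun x y => adjIn G.P₁ x y ∨ (x ∈ G.P₁ ∧ y = G.q)

/-- An extended type-II gadget: a basic type-II gadget together with a directed path
`P₂` of length at least `b` ending at `r`, meeting `P₁` only in `r` and avoiding `q`,
such that either the first vertex of `P₂` sends an arc to the second vertex of `P₁`,
or some vertex of `P₁` other than `r` sends an arc to the first vertex of `P₂`. -/
structure ExtIIGadget (D : V → V → Prop) (b : ℕ) where
  p : V
  q : V
  r : V
  P₁ : List V
  path₁ : IsDipathList D P₁
  first₁ : P₁.head? = some r
  last₁ : P₁.getLast? = some p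
  len₁ : 2 * b ^ 2 + b - 1 ≤ P₁.length
  hq : q ∉ P₁
  toq : ∀ x ∈ P₁, D x q
  P₂ : List V
  path₂ : IsDipathList D P₂
  last₂ : P₂.getLast? = some r
  len₂ : b + 1 ≤ P₂.length
  inter : ∀ x ∈ P₁, x ∈ P₂ → x = r
  hq₂ : q ∉ P₂
  extra : (∃ z y, P₂.head? = some z ∧ P₁[1]? = some y ∧ D z y) ∨
          (∃ w z, w ∈ P₁ ∧ w ≠ r ∧ P₂.head? = some z ∧ D w z)

def ExtIIGadget.verts {D : V → V → Prop} {b : ℕ} (G : ExtIIGadget D b) : Set V :=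
  insert G.q ({x | x ∈ G.P₁} ∪ {x | x ∈ G.P₂})

def ExtIIGadget.arcs {D : V → V → Prop} {b : ℕ} (G : ExtIIGadget D b) : V → V → Prop :=
  fun x y => adjIn G.P₁ x y ∨ (x ∈ G.P₁ ∧ y = G.q) ∨ adjIn G.P₂ x y ∨
    (D x y ∧ ((G.P₂.head? = some x ∧ G.P₁[1]? = some y) ∨
              (x ∈ G.P₁ ∧ x ≠ G.r ∧ G.P₂.head? = some y)))

/-- A type-III gadget: vertices `p, q, r`, the arc `(p,q)`, and two internally
vertex-disjoint directed paths `P₁ : p → r` and `P₂ : q → r`, each of length at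
least `2b - 1`. -/
structure TypeIIIGadget (D : V → V → Prop) (b : ℕ) where
  p : V
  q : V
  r : V
  arc : D p q
  P₁ : List V
  P₂ : List V
  path₁ : IsDipathList D P₁
  path₂ : IsDipathList D P₂
  first₁ : P₁.head? = some p
  first₂ : P₂.head? = some q
  last₁ : P₁.getLast? = some r
  last₂ : P₂.getLast? = some r
  len₁ : 2 * b ≤ P₁.length
  len₂ : 2 * b ≤ P₂.length
  inter : ∀ x ∈ P₁, x ∈ P₂ → x = r

def TypeIIIGadget.verts {D : V → V → Prop} {b : ℕ} (G : TypeIIIGadget D b) : Set V :=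
  {x | x ∈ G.P₁} ∪ {x | x ∈ G.P₂}

def TypeIIIGadget.arcs {D : V → V → Prop} {b : ℕ} (G : TypeIIIGadget D b) :
    V → V → Prop :=
  fun x y => (x = G.p ∧ y = G.q) ∨ adjIn G.P₁ x y ∨ adjIn G.P₂ x y

/-- A trivial gadget: just the arc `(p,q)`. -/
structure TrivGadget (D : V → V → Prop) where
  p : V
  q : V
  arc : D p q

def TrivGadget.verts {D : V → V → Prop} (G : TrivGadget D) : Set V := {G.p, G.q}

def TrivGadget.arcs {D : V → V → Prop} (G : TrivGadget D) : V → V → Prop :=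
  fun x y => x = G.p ∧ y = G.q

/-- An `(a,b)`-alternating path in `D` (with 0-based indexing): vertices
`s 0, …, s (a-1)`, `t 0, …, t (a-1)` and pairwise internally disjoint directed paths
`Q i : s i → t i` and `Q' i : s (i+1) → t i`, forming an oriented path; every `Q' i`
and every `Q i` with `0 < i < a - 1` has length at least `b` (`Q 0` and `Q (a-1)`
may even be single vertices). -/
structure AltPath (D : V → V → Prop) (a b : ℕ) where
  s : Fin a → V
  t : Fin a → V
  Q : Fin a → List V
  Q' : Fin (a - 1) → List V
  path_Q : ∀ i, IsDipathList D (Q i)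
  first_Q : ∀ i, (Q i).head? = some (s i)
  last_Q : ∀ i, (Q i).getLast? = some (t i)
  path_Q' : ∀ i, IsDipathList D (Q' i)
  first_Q' : ∀ i : Fin (a - 1),
    (Q' i).head? = some (s ⟨i.val + 1, by have := i.isLt; omega⟩)
  last_Q' : ∀ i : Fin (a - 1),
    (Q' i).getLast? = some (t ⟨i.val, by have := i.isLt; omega⟩)
  len_Q : ∀ i : Fin a, 0 < i.val → i.val < a - 1 → b + 1 ≤ (Q i).length
  len_Q' : ∀ i, b + 1 ≤ (Q' i).length
  disj_QQ : ∀ i j : Fin a, i ≠ j → ∀ x ∈ Q i, x ∉ Q j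
  disj_Q'Q' : ∀ i j : Fin (a - 1), i ≠ j → ∀ x ∈ Q' i, x ∉ Q' j
  disj_QQ' : ∀ (i : Fin a) (j : Fin (a - 1)), ∀ x ∈ Q i, x ∈ Q' j →
    (j.val = i.val ∧ x = t i) ∨ (i.val = j.val + 1 ∧ x = s i)

def AltPath.verts {D : V → V → Prop} {a b : ℕ} (R : AltPath D a b) : Set V :=
  {x | (∃ i, x ∈ R.Q i) ∨ (∃ i, x ∈ R.Q' i)}

/-- A strong alternating path: additionally `Q 0` and `Q (a-1)` (hence all `Q i`)
have length at least `b`. -/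
def AltPath.Strong {D : V → V → Prop} {a b : ℕ} (R : AltPath D a b) : Prop :=
  ∀ i, b + 1 ≤ (R.Q i).length

def AltPath.arcs {D : V → V → Prop} {a b : ℕ} (R : AltPath D a b) : V → V → Prop :=
  fun x y => (∃ i, adjIn (R.Q i) x y) ∨ (∃ i, adjIn (R.Q' i) x y)

/-- A gadget allowed in a chain: type I (with `g = 4b²`), basic type II, or type III. -/
inductive ChainGadget (D : V → V → Prop) (b : ℕ) where
  | I : TypeIGadget D (4 * b ^ 2) → ChainGadget D b
  | II : BasicIIGadget D b → ChainGadget D b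
  | III : TypeIIIGadget D b → ChainGadget D b

def ChainGadget.pp {D : V → V → Prop} {b : ℕ} : ChainGadget D b → V
  | .I G => G.p
  | .II G => G.p
  | .III G => G.p

def ChainGadget.qq {D : V → V → Prop} {b : ℕ} : ChainGadget D b → V
  | .I G => G.q
  | .II G => G.q
  | .III G => G.q

def ChainGadget.verts {D : V → V → Prop} {b : ℕ} : ChainGadget D b → Set V
  | .I G => G.verts
  | .II G => G.verts
  | .III G => G.verts

def ChainGadget.arcs {D : V → V → Prop} {b : ℕ} : ChainGadget D b → V → V → Prop
  | .I G => G.arcs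
  | .II G => G.arcs
  | .III G => G.arcs

/-- A chain in `D`: a directed path (spine) `v 0, …, v m`, a set `A2` of spine arcs,
and a gadget for every arc in `A2` (arcs outside `A2` form `A1` and carry trivial
gadgets), such that each gadget has the endpoints of its arc as designated vertices,
meets the spine only in these two vertices, and two distinct gadgets meet only in
spine vertices. -/
structure GChain (D : V → V → Prop) (b m : ℕ) where
  v : Fin (m + 1) → V
  inj : Function.Injective v
  spine : ∀ i : Fin m, D (v i.castSucc) (v i.succ)
  A2 : Finset (Fin m)
  gad : (i : Fin m) → i ∈ A2 → ChainGadget D b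
  hp : ∀ (i : Fin m) (hi : i ∈ A2), (gad i hi).pp = v i.castSucc
  hq : ∀ (i : Fin m) (hi : i ∈ A2), (gad i hi).qq = v i.succ
  hspine : ∀ (i : Fin m) (hi : i ∈ A2) (j : Fin (m + 1)),
    v j ∈ (gad i hi).verts → j = i.castSucc ∨ j = i.succ
  hdisj : ∀ (i : Fin m) (hi : i ∈ A2) (j : Fin m) (hj : j ∈ A2), i ≠ j →
    ∀ x, x ∈ (gad i hi).verts → x ∈ (gad j hj).verts → ∃ k, x = v k

def GChain.verts {D : V → V → Prop} {b m : ℕ} (C : GChain D b m) : Set V :=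
  Set.range C.v ∪ {x | ∃ (i : Fin m) (hi : i ∈ C.A2), x ∈ (C.gad i hi).verts}

def GChain.arcs {D : V → V → Prop} {b m : ℕ} (C : GChain D b m) : V → V → Prop :=
  fun x y => (∃ i : Fin m, x = C.v i.castSucc ∧ y = C.v i.succ) ∨
    (∃ (i : Fin m) (hi : i ∈ C.A2), (C.gad i hi).arcs x y)

/-- The vertex set of the gadget `G_e` sitting on the `i`-th spine arc
(the trivial gadget for arcs of `A1`). -/
def GChain.gadVerts {D : V → V → Prop} {b m : ℕ} (C : GChain D b m) (i : Fin m) :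
    Set V :=
  if h : i ∈ C.A2 then (C.gad i h).verts else {C.v i.castSucc, C.v i.succ}

/-- An arbitrary gadget: trivial, type I (with `g = 4b²`), basic or extended type II,
or type III. -/
inductive GadgetAny (D : V → V → Prop) (b : ℕ) where
  | triv : TrivGadget D → GadgetAny D b
  | I : TypeIGadget D (4 * b ^ 2) → GadgetAny D b
  | II : BasicIIGadget D b → GadgetAny D b
  | IIext : ExtIIGadget D b → GadgetAny D b
  | III : TypeIIIGadget D b → GadgetAny D b

def GadgetAny.pp {D : V → V → Prop} {b : ℕ} : GadgetAny D b → V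
  | .triv G => G.p
  | .I G => G.p
  | .II G => G.p
  | .IIext G => G.p
  | .III G => G.p

def GadgetAny.qq {D : V → V → Prop} {b : ℕ} : GadgetAny D b → V
  | .triv G => G.q
  | .I G => G.q
  | .II G => G.q
  | .IIext G => G.q
  | .III G => G.q

def GadgetAny.verts {D : V → V → Prop} {b : ℕ} : GadgetAny D b → Set V
  | .triv G => G.verts
  | .I G => G.verts
  | .II G => G.verts
  | .IIext G => G.verts
  | .III G => G.verts

def GadgetAny.arcs {D : V → V → Prop} {b : ℕ} : GadgetAny D b → V → V → Prop
  | .triv G => G.arcs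
  | .I G => G.arcs
  | .II G => G.arcs
  | .IIext G => G.arcs
  | .III G => G.arcs

end Paper

namespace Paper

/-- Walks with a prescribed number of arcs. -/
def Rch {V : Type*} (D : V → V → Prop) : ℕ → V → V → Prop
  | 0, x, y => x = y
  | n + 1, x, y => ∃ z, D x z ∧ Rch D n z y

/-- The arc `(x,y)` lies on a directed cycle of length exactly `g`. -/
def OnCyc {V : Type*} (D : V → V → Prop) (g : ℕ) (x y : V) : Prop :=
  ∃ rest : List V, (x :: y :: rest).Nodup ∧ List.IsChain D (x :: y :: (rest ++ [x])) ∧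
    rest.length + 2 = g

theorem Rch.trans {V : Type*} {D : V → V → Prop} {n m : ℕ} {x y z : V}
    (h₁ : Rch D n x y) (h₂ : Rch D m y z) : Rch D (n + m) x z := by
  induction n generalizing x with
  | zero => cases h₁; simpa using h₂
  | succ n ih =>
    obtain ⟨w, hw, h⟩ := h₁
    rw [Nat.add_right_comm]
    exact ⟨w, hw, ih h⟩

theorem Rch.one {V : Type*} {D : V → V → Prop} {x y : V} (h : D x y) : Rch D 1 x y :=
  ⟨y, h, rfl⟩

theorem rch_of_chain {V : Type*} {D : V → V → Prop} {x y : V} {l : List V}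
    (h : List.IsChain D (x :: l)) (hl : (x :: l).getLast? = some y) :
    Rch D l.length x y := by
  induction l generalizing x with
  | nil => simpa [Rch] using hl
  | cons a l ih =>
    rw [List.isChain_cons_cons] at h
    exact ⟨a, h.1, ih h.2 (by simpa [List.getLast?_cons_cons] using hl)⟩

theorem rch_to_mem {V : Type*} {D : V → V → Prop} {x w : V} {l : List V}
    (h : List.IsChain D (x :: l)) (hw : w ∈ l) :
    ∃ k, 1 ≤ k ∧ k ≤ l.length ∧ Rch D k x w := by
  induction l generalizing x with
  | nil => simp at hw
  | cons a l ih =>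
    rw [List.isChain_cons_cons] at h
    rcases List.mem_cons.1 hw with rfl | hw
    · exact ⟨1, le_rfl, by simp, Rch.one h.1⟩
    · obtain ⟨k, h1, h2, h3⟩ := ih h.2 hw
      exact ⟨k + 1, by omega, by simpa using h2, a, h.1, h3⟩

theorem rch_from_mem {V : Type*} {D : V → V → Prop} {x y w : V} {l : List V}
    (h : List.IsChain D (x :: l)) (hl : (x :: l).getLast? = some y) (hw : w ∈ x :: l) :
    ∃ k, k ≤ l.length ∧ Rch D k w y := by
  induction l generalizing x with
  | nil =>
    simp at hw hl
    subst hw; subst hl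
    exact ⟨0, le_rfl, rfl⟩
  | cons a l ih =>
    rcases List.mem_cons.1 hw with rfl | hw
    · exact ⟨_, le_rfl, rch_of_chain h hl⟩
    · rw [List.isChain_cons_cons] at h
      obtain ⟨k, h1, h2⟩ := ih h.2 (by simpa [List.getLast?_cons_cons] using hl) hw
      exact ⟨k, by simp; omega, h2⟩

theorem chain_of_rch {V : Type*} {D : V → V → Prop} {n : ℕ} {x y : V}
    (h : Rch D (n + 1) x y) :
    ∃ l : List V, l.length = n ∧ List.IsChain D (x :: (l ++ [y])) := by
  induction n generalizing x with
  | zero =>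
    obtain ⟨z, hz, h⟩ := h
    cases h
    exact ⟨[], rfl, by simpa using hz⟩
  | succ n ih =>
    obtain ⟨z, hz, h⟩ := h
    obtain ⟨l, h1, h2⟩ := ih h
    exact ⟨z :: l, by simp [h1], by
      rw [List.cons_append, List.isChain_cons_cons]; exact ⟨hz, h2⟩⟩

theorem closed_of_not_nodup {V : Type*} {D : V → V → Prop} {l : List V}
    (h : List.IsChain D l) (hn : ¬ l.Nodup) :
    ∃ a k, 1 ≤ k ∧ k < l.length ∧ Rch D k a a := by
  induction l with
  | nil => simp at hn
  | cons x l ih =>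
    by_cases hx : x ∈ l
    · obtain ⟨k, h1, h2, h3⟩ := rch_to_mem h hx
      exact ⟨x, k, h1, by simp; omega, h3⟩
    · obtain ⟨a, k, h1, h2, h3⟩ := ih h.tail (fun hh => hn (List.nodup_cons.2 ⟨hx, hh⟩))
      exact ⟨a, k, h1, by simp; omega, h3⟩

theorem girth_closed {V : Type*} {D : V → V → Prop} {g : ℕ} (hg : DirGirthGE D g) :
    ∀ (n : ℕ) (x : V), 1 ≤ n → Rch D n x x → g ≤ n := by
  intro n
  induction n using Nat.strong_induction_on with
  | _ n ih =>
    intro x hn h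
    obtain ⟨n, rfl⟩ : ∃ m, n = m + 1 := ⟨n - 1, by omega⟩
    obtain ⟨l, h1, h2⟩ := chain_of_rch h
    by_cases hnd : (x :: l).Nodup
    · have := hg x l hnd h2
      omega
    · have hc : List.IsChain D (x :: l) := by
        rw [← List.cons_append] at h2
        exact h2.left_of_append
      obtain ⟨a, k, k1, k2, k3⟩ := closed_of_not_nodup hc hnd
      simp at k2
      have := ih k (by omega) a k1 k3
      omega

theorem girth_nodup {V : Type*} {D : V → V → Prop} {g : ℕ} (hg : DirGirthGE D g)
    {l : List V} (h : List.IsChain D l) (hl : l.length ≤ g) : l.Nodup := by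
  by_contra hn
  obtain ⟨a, k, k1, k2, k3⟩ := closed_of_not_nodup h hn
  have := girth_closed hg k a k1 k3
  omega

theorem tower {V : Type*} {D : V → V → Prop} {g : ℕ}
    (harc : ∀ x y, D x y → OnCyc D g x y ∨ (∃ z, z ≠ x ∧ z ≠ y ∧ D z x ∧ D z y))
    {p q : V} (hpq : D p q) (m : ℕ) :
    ∃ (u : V) (L : List V), List.IsChain D (u :: L) ∧ (u :: L).getLast? = some p ∧
      (∀ x ∈ u :: L, D x q) ∧
      ((L.length = m ∧ ∀ x ∈ L, ¬ OnCyc D g x q) ∨ (L.length < m ∧ OnCyc D g u q)) := by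
  induction m with
  | zero => exact ⟨p, [], by simp, by simp, by simpa using hpq, Or.inl (by simp)⟩
  | succ m ih =>
    obtain ⟨u, L, h1, h2, h3, h4⟩ := ih
    rcases h4 with ⟨h4, h5⟩ | ⟨h4, h5⟩
    · by_cases hc : OnCyc D g u q
      · exact ⟨u, L, h1, h2, h3, Or.inr ⟨by omega, hc⟩⟩
      · obtain hc' | ⟨z, -, -, hzu, hzq⟩ := harc u q (h3 u (by simp))
        · exact absurd hc' hc
        · refine ⟨z, u :: L, List.isChain_cons_cons.2 ⟨hzu, h1⟩, ?_, ?_, Or.inl ⟨by simp [h4], ?_⟩⟩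
          · simpa [List.getLast?_cons_cons] using h2
          · intro x hx
            rcases List.mem_cons.1 hx with rfl | hx
            · exact hzq
            · exact h3 x hx
          · intro x hx
            rcases List.mem_cons.1 hx with rfl | hx
            · exact hc
            · exact h5 x hx
    · exact ⟨u, L, h1, h2, h3, Or.inr ⟨by omega, h5⟩⟩

theorem cyc_nodup {V : Type*} {D : V → V → Prop} {g : ℕ} (hloop : ∀ v, ¬ D v v)
    (hg : DirGirthGE D g)
    {u q : V} {L rest : List V} (hc : List.IsChain D (u :: L)) (hlen : L.length < g)
    (hq : ∀ x ∈ u :: L, D x q)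
    (hnd : (u :: q :: rest).Nodup) (hch : List.IsChain D (u :: q :: (rest ++ [u])))
    (hr : rest.length + 2 = g) :
    (q :: (rest ++ u :: L)).Nodup ∧ List.IsChain D (q :: (rest ++ u :: L)) := by
  have hch2 : List.IsChain D (q :: (rest ++ [u])) := hch.tail
  have hch3 : List.IsChain D (q :: rest) := by
    rw [← List.cons_append] at hch2
    exact hch2.left_of_append
  constructor
  · have hqr := (List.nodup_cons.1 hnd).2
    rw [← List.cons_append]
    refine List.Nodup.append hqr (girth_nodup hg hc (by simp; omega)) ?_
    intro x hx hx'
    have hxq := hq x hx'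
    rcases List.mem_cons.1 hx with rfl | hx
    · exact hloop _ hxq
    · obtain ⟨k, k1, k2, k3⟩ := rch_to_mem hch3 hx
      have := girth_closed hg _ _ (by omega) (k3.trans (Rch.one hxq))
      omega
  · rw [← List.cons_append] at hch2 ⊢
    rw [List.isChain_split]
    exact ⟨hch2, hc⟩

theorem last_split {V : Type*} (P : V → Prop) (l : List V) (h : ∃ x ∈ l, P x) :
    ∃ l₁ w l₂, l = l₁ ++ w :: l₂ ∧ P w ∧ ∀ x ∈ l₂, ¬ P x := by
  induction l with
  | nil => simp at h
  | cons a l ih =>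
    by_cases hl : ∃ x ∈ l, P x
    · obtain ⟨l₁, w, l₂, rfl, h2, h3⟩ := ih hl
      exact ⟨a :: l₁, w, l₂, rfl, h2, h3⟩
    · push Not at hl
      obtain ⟨x, hx, hP⟩ := h
      rcases List.mem_cons.1 hx with rfl | hx
      · exact ⟨[], x, l, rfl, hP, hl⟩
      · exact absurd hP (hl x hx)

theorem ncard_le_of_list {V : Type*} (S : Set V) (l : List V) (h : ∀ x ∈ S, x ∈ l) :
    S.ncard ≤ l.length := by
  classical
  calc S.ncard ≤ (↑l.toFinset : Set V).ncard :=
        Set.ncard_le_ncard (fun x hx => by simpa using h x hx) (Finset.finite_toSet _)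
    _ = l.toFinset.card := Set.ncard_coe_finset _
    _ ≤ l.length := List.toFinset_card_le l

/-- Let `D` have directed girth at least `g = 4b²` and suppose for
every arc `(x,y)` either `D` has a directed cycle of length exactly `g` through
`(x,y)`, or some `z ∉ {x,y}` sends arcs to both `x` and `y`. Then for every arc
`(p,q)` there is a type-I or extended type-II gadget `G ⊆ D` with `p(G) = p`,
`q(G) = q` and at most `2g` vertices. -/
theorem stmt_13 {V : Type*} [Fintype V] (D : V → V → Prop) (hloop : ∀ v, ¬ D v v)
    (b : ℕ) (hb : 1 ≤ b) (hgirth : DirGirthGE D (4 * b ^ 2))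
    (harc : ∀ x y, D x y →
      (∃ rest : List V, (x :: y :: rest).Nodup ∧ List.Chain D x (y :: (rest ++ [x])) ∧
        rest.length + 2 = 4 * b ^ 2) ∨
      (∃ z, z ≠ x ∧ z ≠ y ∧ D z x ∧ D z y)) :
    ∀ p q, D p q →
      (∃ G : TypeIGadget D (4 * b ^ 2), G.p = p ∧ G.q = q ∧
        G.verts.ncard ≤ 2 * (4 * b ^ 2)) ∨
      (∃ G : ExtIIGadget D b, G.p = p ∧ G.q = q ∧
        G.verts.ncard ≤ 2 * (4 * b ^ 2)) := by
  have harc' : ∀ x y, D x y →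
      OnCyc D (4 * b ^ 2) x y ∨ (∃ z, z ≠ x ∧ z ≠ y ∧ D z x ∧ D z y) := harc
  intro p q hpq
  have hs : 2 * b ≤ b ^ 2 + 1 := by nlinarith [sq_nonneg ((b : ℤ) - 1)]
  have hs1 : b ≤ b ^ 2 := by nlinarith
  have hgc := girth_closed hgirth
  set s := b ^ 2 with hsdef
  obtain ⟨r, L, hL1, hL2, hL3, hL4⟩ := tower harc' hpq (2 * s + b - 2)
  have hqP : q ∉ r :: L := fun h => hloop q (hL3 q h)
  rcases hL4 with ⟨hLlen, hLno⟩ | ⟨hLlen, rest, hc1, hc2, hc3⟩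
  · right
    obtain ⟨y, L', rfl⟩ : ∃ y L', L = y :: L' := by
      cases L with
      | nil => simp at hLlen; omega
      | cons y L' => exact ⟨y, L', rfl⟩
    have hry : D r y := (List.isChain_cons_cons.1 hL1).1
    have hnd1 : (r :: y :: L').Nodup := girth_nodup hgirth hL1 (by
      rw [List.length_cons, hLlen]; omega)
    have hyr : r ∉ y :: L' := (List.nodup_cons.1 hnd1).1
    have hyq : D y q := hL3 y (by simp)
    have hrq : D r q := hL3 r (by simp)
    obtain ⟨u, M, hM1, hM2, hM3, hM4⟩ := tower harc' hry b
    have hMle : M.length ≤ b := by rcases hM4 with h | h <;> omega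
    have hqM : q ∉ u :: M := by
      intro h
      obtain ⟨k, k1, k2⟩ := rch_from_mem hM1 hM2 h
      have := hgc _ _ (by omega) (k2.trans (Rch.one hrq))
      omega
    rcases hM4 with ⟨hMlen, -⟩ | ⟨hMlen, rest, hc1, hc2, hc3⟩
    · refine ⟨⟨p, q, r, r :: y :: L', ⟨by simp, hnd1, hL1⟩, rfl, hL2, ?_, hqP, hL3,
        u :: M, ⟨by simp, girth_nodup hgirth hM1 ?_, hM1⟩, hM2, ?_, ?_, hqM,
        Or.inl ⟨u, y, rfl, rfl, hM3 u (by simp)⟩⟩, rfl, rfl, ?_⟩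
      · rw [List.length_cons, hLlen]; omega
      · rw [List.length_cons, hMlen]; omega
      · rw [List.length_cons, hMlen]
      · intro x hx hx'
        rcases List.mem_cons.1 hx with rfl | hx
        · rfl
        · exfalso
          obtain ⟨j, j1, j2, j3⟩ := rch_to_mem hL1 hx
          obtain ⟨k, k1, k2⟩ := rch_from_mem hM1 hM2 hx'
          have := hgc _ _ (by omega) (j3.trans k2)
          omega
      · refine (ncard_le_of_list _ (q :: ((r :: y :: L') ++ (u :: M))) ?_).trans ?_
        · intro x hx
          simp only [ExtIIGadget.verts, Set.mem_insert_iff, Set.mem_union,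
            Set.mem_setOf_eq] at hx
          simp only [List.mem_cons, List.mem_append] at hx ⊢
          tauto
        · rw [List.length_cons, List.length_append, List.length_cons, hLlen,
            List.length_cons, hMlen]
          omega
    · obtain ⟨hWnd, hWch⟩ := cyc_nodup hloop hgirth hM1 (by omega) hM3 hc1 hc2 hc3
      have hWlast : (y :: (rest ++ u :: M)).getLast? = some r := by
        rw [← List.cons_append, List.getLast?_append, hM2]; rfl
      have hqW : q ∉ y :: (rest ++ u :: M) := by
        intro h
        rcases List.mem_cons.1 h with rfl | h
        · exact hloop _ hyq
        rcases List.mem_append.1 h with h | h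
        · obtain ⟨a, c, rfl⟩ := List.append_of_mem h
          cases a with
          | nil =>
            refine hLno y (by simp) ⟨c ++ [u], ?_, ?_, ?_⟩
            · have : (y :: q :: (c ++ [u])).Perm (u :: y :: ([] ++ q :: c)) := by
                have := List.perm_append_singleton u (y :: q :: c)
                simpa using this
              exact this.nodup_iff.2 hc1
            · have h1 : List.IsChain D ((y :: q :: c) ++ [u]) := by simpa using hc2.tail
              have : List.IsChain D ((y :: q :: c) ++ u :: [y]) := by
                rw [List.isChain_split]
                exact ⟨h1, by simpa using hM3 u (by simp)⟩
              simpa using this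
            · simpa using hc3
          | cons a₀ a =>
            have h1 : List.IsChain D ((u :: y :: a₀ :: a) ++ q :: (c ++ [u])) := by
              simpa using hc2
            have h2 := (List.isChain_split.1 h1).2
            have h3 := rch_of_chain (y := u) h2 (by
              rw [← List.cons_append, List.getLast?_append]; rfl)
            have := hgc _ _ (by omega)
              ((Rch.one hyq).trans (h3.trans (Rch.one (hM3 u (by simp)))))
            simp at this hc3
            omega
        · exact hqM h
      obtain ⟨l₁, w, l₂, hsplit, hw, hl₂⟩ := last_split (· ∈ y :: L')
        (y :: (rest ++ u :: M)) ⟨y, by simp, by simp⟩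
      have hlenW : l₁.length + (l₂.length + 1) = rest.length + (M.length + 1) + 1 := by
        have := congrArg List.length hsplit
        simpa using this.symm
      rw [hsplit] at hWnd hWch hWlast hqW
      have hwch : List.IsChain D (w :: l₂) := hWch.right_of_append
      have hwlast : (w :: l₂).getLast? = some r := by
        rw [List.getLast?_append] at hWlast
        simpa [List.getLast?_cons] using hWlast
      cases l₂ with
      | nil =>
        simp at hwlast
        exact absurd (hwlast ▸ hw) hyr
      | cons z T =>
        have hlen2 : b + 1 ≤ (z :: T).length := by
          obtain ⟨j, j1, j2, j3⟩ := rch_to_mem hL1 hw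
          have := hgc _ _ (by omega) (j3.trans (rch_of_chain hwch hwlast))
          omega
        refine ⟨⟨p, q, r, r :: y :: L', ⟨by simp, hnd1, hL1⟩, rfl, hL2, ?_, hqP, hL3,
          z :: T, ⟨by simp, ?_, hwch.tail⟩, ?_, hlen2, ?_, ?_,
          Or.inr ⟨w, z, List.mem_cons_of_mem _ hw, ?_, rfl,
            (List.isChain_cons_cons.1 hwch).1⟩⟩, rfl, rfl, ?_⟩
        · rw [List.length_cons, hLlen]; omega
        · exact (List.nodup_cons.1 (List.nodup_append.1 hWnd).2.1).2
        · simpa [List.getLast?_cons_cons] using hwlast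
        · intro x hx hx'
          rcases List.mem_cons.1 hx with rfl | hx
          · rfl
          · exact absurd hx (hl₂ x hx')
        · intro h
          exact hqW (by simp only [List.mem_append, List.mem_cons] at h ⊢; tauto)
        · rintro rfl
          exact hyr hw
        · refine (ncard_le_of_list _ (q :: ((r :: y :: L') ++ (z :: T))) ?_).trans ?_
          · intro x hx
            simp only [ExtIIGadget.verts, Set.mem_insert_iff, Set.mem_union,
              Set.mem_setOf_eq] at hx
            simp only [List.mem_cons, List.mem_append] at hx ⊢
            tauto
          · rw [List.length_cons, List.length_append, List.length_cons, hLlen]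
            omega
  · left
    obtain ⟨hWnd, hWch⟩ := cyc_nodup hloop hgirth hL1 (by omega) hL3 hc1 hc2 hc3
    obtain ⟨K, hK⟩ : ∃ K, r :: L = K ++ [p] := by
      obtain ⟨K, hK⟩ := List.getLast?_eq_some_iff.1 hL2
      exact ⟨K, hK⟩
    have hKlen : L.length = K.length := by
      have := congrArg List.length hK
      simpa using this
    rw [hK] at hWnd hWch
    refine ⟨⟨p, q, rest ++ K, ?_, ?_, ?_⟩, rfl, rfl, ?_⟩
    · have : (p :: q :: (rest ++ K)).Perm (q :: (rest ++ (K ++ [p]))) := by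
        have := (List.perm_append_singleton p (q :: (rest ++ K))).symm
        simpa using this
      exact this.nodup_iff.2 hWnd
    · refine List.isChain_cons_cons.2 ⟨hpq, ?_⟩
      simpa using hWch
    · simp; omega
    · refine (ncard_le_of_list _ (p :: q :: (rest ++ K)) (fun x hx => hx)).trans ?_
      simp; omega

end Paper
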